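/- Let n ≥ 2, 0 ≤ k ≤ ⌊n/3⌋, and 1 ≤ i < d ≤ ⌊(1+√(1+8k))/2⌋. Then for every subset A of C_n with |A| = i, the number of zero-sum free sequences of length n−1−k over C_n having exactly d distinct elements whose support contains A is at most [ i·C(k,i−1) + C(k,i) ] · Σ_{j=0}^{i} X_{k−i+1, d−1−j}, where C(·,·) denotes the binomial coefficient. -/

import Mathlib

open MeasureTheory Filter

noncomputable def ZeroSumFree {n : ℕ} (S : Multiset (ZMod n)) : Prop :=
  ∀ T : Multiset (ZMod n), T ≤ S → T ≠ 0 → T.sum ≠ 0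

/-- `q j d`: number of partitions of `j` with exactly `d` distinct part sizes. -/
noncomputable def numPartsDistinct (j d : ℕ) : ℕ :=
  Nat.card {l : Nat.Partition j // l.parts.toFinset.card = d}

/-- `X k d`: number of partitions of integers at most `k` with exactly `d` distinct part sizes. -/
noncomputable def X (k d : ℕ) : ℕ := ∑ j ∈ Finset.range (k + 1), numPartsDistinct j d

/-- `Y b c d`: number of partitions of integers at most `b` with at most `c` parts and
exactly `d` distinct part sizes. -/
noncomputable def Y (b c d : ℕ) : ℕ :=
  ∑ j ∈ Finset.range (b + 1),
    Nat.card {l : Nat.Partition j //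
      Multiset.card l.parts ≤ c ∧ l.parts.toFinset.card = d}

/-- `N_{ℓ,d}` over `C_n`. -/
noncomputable def zsfCountD (n ℓ d : ℕ) : ℕ :=
  Nat.card {S : Multiset (ZMod n) //
    Multiset.card S = ℓ ∧ ZeroSumFree S ∧ S.toFinset.card = d}

/-- `N_ℓ` over `C_n`. -/
noncomputable def zsfCount (n ℓ : ℕ) : ℕ :=
  Nat.card {S : Multiset (ZMod n) // Multiset.card S = ℓ ∧ ZeroSumFree S}

/-- Bernoulli(p) measure on `Bool` (for `p ∈ [0,1]`, `min (ofReal p) 1 = ofReal p`). -/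
noncomputable def bernoulliMeasure (p : ℝ) : Measure Bool :=
  (PMF.bernoulli (min (Real.toNNReal p) 1) (min_le_right _ _)).toMeasure

/-- Product of Bernoulli(p) measures on `ZMod n → Bool`. -/
noncomputable def productMeasure : (n : ℕ) → ℝ → Measure (ZMod n → Bool)
  | 0, _ => 0
  | (_ + 1), p => Measure.pi fun _ => bernoulliMeasure p

/-- `N^R_ℓ` : number of zero-sum free multisets of cardinality `ℓ` contained in
`R(f) = {a | f a = true}`. -/
noncomputable def NRcount (n ℓ : ℕ) (f : ZMod n → Bool) : ℕ :=
  Nat.card {S : Multiset (ZMod n) //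
    Multiset.card S = ℓ ∧ ZeroSumFree S ∧ ∀ a ∈ S, f a = true}

/-- `N^R_{ℓ,d}` : those with support of size `d`. -/
noncomputable def NRcountD (n ℓ d : ℕ) (f : ZMod n → Bool) : ℕ :=
  Nat.card {S : Multiset (ZMod n) //
    Multiset.card S = ℓ ∧ ZeroSumFree S ∧ S.toFinset.card = d ∧ ∀ a ∈ S, f a = true}

/-- `D = ⌊(1+√(1+8k))/2⌋`. -/
noncomputable def Dk (k : ℕ) : ℕ := Nat.floor ((1 + Real.sqrt (1 + 8 * (k : ℝ))) / 2)


section SC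
variable {G : Type*} [AddCommGroup G] [DecidableEq G]

def scSums (S : Multiset G) : Finset G := (S.powerset.map Multiset.sum).toFinset

def scFree (S : Multiset G) : Prop := ∀ T : Multiset G, T ≤ S → T ≠ 0 → T.sum ≠ 0

lemma mem_scSums {S : Multiset G} {x : G} : x ∈ scSums S ↔ ∃ T, T ≤ S ∧ T.sum = x := by
  simp [scSums]

lemma mem_scSums_cons {S : Multiset G} {b x : G} :
    x ∈ scSums (b ::ₘ S) ↔ x ∈ scSums S ∨ x - b ∈ scSums S := by
  simp only [scSums, Multiset.powerset_cons, Multiset.map_add, Multiset.map_map,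
    Multiset.mem_toFinset, Multiset.mem_add, Multiset.mem_map, Multiset.mem_powerset,
    Function.comp, Multiset.sum_cons]
  constructor
  · rintro (h | ⟨T, h, rfl⟩)
    · exact Or.inl h
    · exact Or.inr ⟨T, h, by abel⟩
  · rintro (h | ⟨T, h, h2⟩)
    · exact Or.inl h
    · exact Or.inr ⟨T, h, by rw [h2]; abel⟩

lemma scFree.mono {S T : Multiset G} (h : scFree S) (hT : T ≤ S) : scFree T :=
  fun U hU => h U (hU.trans hT)

lemma zero_mem_scSums (S : Multiset G) : (0 : G) ∈ scSums S :=
  mem_scSums.2 ⟨0, Multiset.zero_le _, rfl⟩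

lemma scSums_symm {S : Multiset G} {x : G} (h : x ∈ scSums S) : S.sum - x ∈ scSums S := by
  obtain ⟨T, hT, rfl⟩ := mem_scSums.1 h
  refine mem_scSums.2 ⟨S - T, tsub_le_self, ?_⟩
  have : (S - T).sum + T.sum = S.sum := by
    rw [← Multiset.sum_add, tsub_add_cancel_of_le hT]
  rw [← this]; abel

lemma scFree.neg_notMem {S : Multiset G} {b : G} (h : scFree (b ::ₘ S)) : -b ∉ scSums S := by
  intro hb
  obtain ⟨T, hT, h2⟩ := mem_scSums.1 hb
  refine h (b ::ₘ T) ((Multiset.cons_le_cons_iff b).2 hT) (Multiset.cons_ne_zero) ?_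
  rw [Multiset.sum_cons, h2]; abel

lemma scFree.top_notMem {S : Multiset G} {b : G} (h : scFree (b ::ₘ S)) :
    S.sum + b ∉ scSums S := by
  intro hb
  have := scSums_symm hb
  apply h.neg_notMem
  convert this using 1; abel

lemma scFree.ne_zero {S : Multiset G} {b : G} (h : scFree S) (hb : b ∈ S) : b ≠ 0 := by
  have := h {b} (Multiset.singleton_le.2 hb) (Multiset.singleton_ne_zero b)
  simpa using this

lemma scSums_subset_cons (S : Multiset G) (b : G) : scSums S ⊆ scSums (b ::ₘ S) :=
  fun _ hx => mem_scSums_cons.2 (Or.inl hx)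

lemma sum_mem_scSums (S : Multiset G) : S.sum ∈ scSums S := mem_scSums.2 ⟨S, le_rfl, rfl⟩

lemma insert_subset_scSums_cons (S : Multiset G) (b : G) :
    insert (S.sum + b) (scSums S) ⊆ scSums (b ::ₘ S) := by
  intro x hx
  rcases Finset.mem_insert.1 hx with rfl | hx
  · refine mem_scSums_cons.2 (Or.inr ?_)
    simpa using sum_mem_scSums S
  · exact scSums_subset_cons S b hx

lemma scFree.grow {S : Multiset G} {b : G} (h : scFree (b ::ₘ S)) :
    (scSums S).card + 1 ≤ (scSums (b ::ₘ S)).card := by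
  rw [← Finset.card_insert_of_notMem h.top_notMem]
  exact Finset.card_le_card (insert_subset_scSums_cons S b)

lemma scFree.one {S : Multiset G} {b : G} (h : scFree (b ::ₘ S))
    (h1 : (scSums (b ::ₘ S)).card ≤ (scSums S).card + 1) :
    scSums (b ::ₘ S) = insert (S.sum + b) (scSums S) := by
  symm
  apply Finset.eq_of_subset_of_card_le (insert_subset_scSums_cons S b)
  rwa [Finset.card_insert_of_notMem h.top_notMem]

lemma scFree.step {S : Multiset G} {b x : G} (h : scFree (b ::ₘ S))
    (h1 : (scSums (b ::ₘ S)).card ≤ (scSums S).card + 1) (hx : x ∈ scSums S)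
    (hne : x ≠ S.sum) : x + b ∈ scSums S := by
  have : x + b ∈ scSums (b ::ₘ S) := mem_scSums_cons.2 (Or.inr (by simpa using hx))
  rw [h.one h1] at this
  rcases Finset.mem_insert.1 this with h2 | h2
  · exact absurd (add_right_cancel h2) hne
  · exact h2

lemma sc_D {T : Multiset G} {b c : G} (hT : T ≠ 0) (hb : scFree (b ::ₘ T))
    (hc : scFree (c ::ₘ T)) (hb1 : (scSums (b ::ₘ T)).card ≤ (scSums T).card + 1)
    (hc1 : (scSums (c ::ₘ T)).card ≤ (scSums T).card + 1) : b = c := by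
  by_contra hne
  have hs : T.sum ≠ 0 := hb T (Multiset.le_cons_self _ _) hT
  have c0 : c ≠ 0 := hc.ne_zero (Multiset.mem_cons_self _ _)
  have h1 : c ∈ scSums T := by
    simpa using hc.step hc1 (zero_mem_scSums T) hs.symm
  have h2 := hb.step hb1 (scSums_symm h1) (by simpa using c0)
  have h3 := hc.step hc1 h2 (by
    intro h; apply hne
    have : T.sum - c + b = T.sum - c + c := by rw [h]; abel
    exact add_left_cancel this)
  apply hb.top_notMem
  convert h3 using 1; abel

lemma sc_U_aux {S S1 S2 : Multiset G} {b c : G} (hS : scFree S) (e1 : S = b ::ₘ S1)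
    (e2 : S = c ::ₘ S2) (hb1 : (scSums S).card ≤ (scSums S1).card + 1)
    (hc1 : (scSums S).card ≤ (scSums S2).card + 1) (hne : b ≠ c) : S.sum = -b := by
  have hb : scFree (b ::ₘ S1) := e1 ▸ hS
  have hc : scFree (c ::ₘ S2) := e2 ▸ hS
  have s1 : S.sum = S1.sum + b := by rw [e1, Multiset.sum_cons, add_comm]
  have s2 : S.sum = S2.sum + c := by rw [e2, Multiset.sum_cons, add_comm]
  have o1 := hb.one (e1 ▸ hb1)
  have o2 := hc.one (e2 ▸ hc1)
  rw [← e1, ← s1] at o1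
  rw [← e2, ← s2] at o2
  have c0 : c ≠ 0 := hc.ne_zero (Multiset.mem_cons_self _ _)
  have hcS : c ∈ scSums S := mem_scSums.2 ⟨{c}, by
    rw [e2]; exact Multiset.singleton_le.2 (Multiset.mem_cons_self _ _), by simp⟩
  have st1 : ∀ x ∈ scSums S, x ≠ S.sum → x + b ∈ scSums S := by
    intro x hx hxs
    rw [o1] at hx
    have hx := Finset.mem_of_mem_insert_of_ne hx hxs
    rw [e1]
    exact mem_scSums_cons.2 (Or.inr (by simpa using hx))
  have st2 : ∀ x ∈ scSums S, x ≠ S.sum → x + c ∈ scSums S := by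
    intro x hx hxs
    rw [o2] at hx
    have hx := Finset.mem_of_mem_insert_of_ne hx hxs
    rw [e2]
    exact mem_scSums_cons.2 (Or.inr (by simpa using hx))
  have h2 := st1 _ (scSums_symm hcS) (by simpa using c0)
  have h3 := st2 _ h2 (by
    intro h; apply hne
    have : S.sum - c + b = S.sum - c + c := by rw [h]; abel
    exact add_left_cancel this)
  have h4 := scSums_symm h3
  have h5 : -b ∈ scSums S := by convert h4 using 1; abel
  by_contra h6
  rw [o1] at h5
  exact hb.neg_notMem (Finset.mem_of_mem_insert_of_ne h5 (Ne.symm h6))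

lemma sc_U {S S1 S2 : Multiset G} {b c : G} (hS : scFree S) (e1 : S = b ::ₘ S1)
    (e2 : S = c ::ₘ S2) (hb1 : (scSums S).card ≤ (scSums S1).card + 1)
    (hc1 : (scSums S).card ≤ (scSums S2).card + 1) : b = c := by
  by_contra hne
  have h1 := sc_U_aux hS e1 e2 hb1 hc1 hne
  have h2 := sc_U_aux hS e2 e1 hc1 hb1 (Ne.symm hne)
  exact hne (neg_injective (h1.symm.trans h2))

lemma scSums_cons_eq (S : Multiset G) (b : G) :
    scSums (b ::ₘ S) = scSums S ∪ (scSums S).image (· + b) := by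
  ext x
  rw [mem_scSums_cons, Finset.mem_union, Finset.mem_image]
  constructor
  · rintro (h | h)
    · exact Or.inl h
    · exact Or.inr ⟨_, h, by abel⟩
  · rintro (h | ⟨y, h, rfl⟩)
    · exact Or.inl h
    · exact Or.inr (by simpa using h)

/-- repeated one-extension by the same element -/
lemma sc_repeat {T : Multiset G} {b : G} (r : ℕ) (h : scFree (Multiset.replicate (r+1) b + T))
    (h1 : (scSums (b ::ₘ T)).card ≤ (scSums T).card + 1) :
    (scSums (Multiset.replicate (r+1) b + T)).card
      ≤ (scSums (Multiset.replicate r b + T)).card + 1 := by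
  induction r with
  | zero => simpa using h1
  | succ r ih =>
    rw [Multiset.replicate_succ, Multiset.cons_add] at h
    have ih := ih (h.mono (Multiset.le_cons_self _ _))
    set W := Multiset.replicate r b + T with hW
    have e1 : Multiset.replicate (r+1) b + T = b ::ₘ W := by
      rw [Multiset.replicate_succ, Multiset.cons_add]
    have e2 : Multiset.replicate (r+1+1) b + T = b ::ₘ b ::ₘ W := by
      rw [Multiset.replicate_succ, Multiset.cons_add, e1]
    rw [e1] at ih h
    rw [e2, e1]
    have hf : scFree (b ::ₘ W) := h.mono (Multiset.le_cons_self _ _)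
    have : scSums (b ::ₘ b ::ₘ W) ⊆ insert ((b ::ₘ W).sum + b) (scSums (b ::ₘ W)) := by
      intro x hx
      rcases mem_scSums_cons.1 hx with hx | hx
      · exact Finset.mem_insert_of_mem hx
      · rw [hf.one ih] at hx
        rcases Finset.mem_insert.1 hx with hx | hx
        · rw [Multiset.sum_cons]
          refine Finset.mem_insert.2 (Or.inl ?_)
          rw [sub_eq_iff_eq_add] at hx
          rw [hx]; abel
        · exact Finset.mem_insert_of_mem (mem_scSums_cons.2 (Or.inr hx))
    exact (Finset.card_le_card this).trans (Finset.card_insert_le _ _)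

lemma sc_E (m : ℕ) {S Z : Multiset G} (hm : Multiset.card (S - Z) = m) (hS : scFree S)
    (hZ0 : Z ≠ 0) (hZ : Z ≤ S)
    (he : (scSums S).card + 2 * Multiset.card Z < (scSums Z).card + 2 * Multiset.card S) :
    ∃ b S1, S = b ::ₘ S1 ∧ Z ≤ S1 ∧ (scSums S).card ≤ (scSums S1).card + 1 := by
  induction m generalizing Z with
  | zero =>
    have : S = Z := by
      have h := Multiset.card_eq_zero.1 hm
      exact le_antisymm (tsub_eq_zero_iff_le.1 h) hZ
    subst this
    exact absurd he (lt_irrefl _)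
  | succ m ih =>
    have hadd : S - Z + Z = S := tsub_add_cancel_of_le hZ
    by_cases hex : ∃ c ∈ S - Z, (scSums Z).card + 2 ≤ (scSums (c ::ₘ Z)).card
    · obtain ⟨c, hc, hc2⟩ := hex
      have hle : c ::ₘ Z ≤ S := by
        rw [← hadd, ← Multiset.singleton_add]
        exact add_le_add_left (Multiset.singleton_le.2 hc) Z
      obtain ⟨b, S1, h1, h2, h3⟩ := ih (Z := c ::ₘ Z) (by
        rw [Multiset.card_sub hle, Multiset.card_cons]
        rw [Multiset.card_sub hZ] at hm; omega) Multiset.cons_ne_zero hle (by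
        rw [Multiset.card_cons]; omega)
      exact ⟨b, S1, h1, (Multiset.le_cons_self _ _).trans h2, h3⟩
    · push Not at hex
      have hcz : ∀ c ∈ S - Z, scFree (c ::ₘ Z) := by
        intro c hc
        apply hS.mono
        rw [← hadd, ← Multiset.singleton_add]
        exact add_le_add_left (Multiset.singleton_le.2 hc) Z
      obtain ⟨b, hb⟩ : ∃ b, b ∈ S - Z := Multiset.card_pos_iff_exists_mem.1 (by omega)
      have hall : ∀ c ∈ S - Z, c = b := fun c hc =>
        sc_D hZ0 (hcz c hc) (hcz b hb) (by have := hex c hc; omega) (by have := hex b hb; omega)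
      have hrep : S - Z = Multiset.replicate (m+1) b := Multiset.eq_replicate.2 ⟨hm, hall⟩
      rw [hrep] at hadd
      refine ⟨b, Multiset.replicate m b + Z, ?_, Multiset.le_add_left _ _, ?_⟩
      · rw [← hadd, Multiset.replicate_succ, Multiset.cons_add]
      · rw [← hadd]
        exact sc_repeat m (hadd ▸ hS) (by have := hex b hb; omega)

/-- interval structure -/
def scInt (b : G) (L : Multiset ℕ) : Prop :=
  (∀ x ∈ L, 1 ≤ x) ∧ L.sum < addOrderOf b ∧
    scSums (L.map (· • b)) = (Finset.range (L.sum + 1)).image (· • b)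

lemma scInt.cons {b : G} {L : Multiset ℕ} (h : scInt b L) {x : ℕ} (hx : 1 ≤ x)
    (hx2 : x ≤ L.sum + 1) (hf : scFree ((x • b) ::ₘ L.map (· • b))) : scInt b (x ::ₘ L) := by
  obtain ⟨h1, h2, h3⟩ := h
  have hlt : x + L.sum < addOrderOf b := by
    by_contra hge
    push Not at hge
    apply hf.neg_notMem
    rw [h3, Finset.mem_image]
    refine ⟨addOrderOf b - x, by rw [Finset.mem_range]; omega, ?_⟩
    have : (addOrderOf b - x) • b + x • b = 0 := by
      rw [← add_nsmul, Nat.sub_add_cancel (by omega), addOrderOf_nsmul_eq_zero]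
    exact eq_neg_of_add_eq_zero_left this
  refine ⟨?_, ?_, ?_⟩
  · intro y hy
    rcases Multiset.mem_cons.1 hy with rfl | hy
    · exact hx
    · exact h1 y hy
  · rwa [Multiset.sum_cons]
  · rw [Multiset.map_cons, scSums_cons_eq, h3, Multiset.sum_cons]
    ext y
    simp only [Finset.mem_union, Finset.mem_image, Finset.mem_range]
    constructor
    · rintro (⟨j, hj, rfl⟩ | ⟨_, ⟨j, hj, rfl⟩, rfl⟩)
      · exact ⟨j, by omega, rfl⟩
      · exact ⟨j + x, by omega, by rw [add_nsmul]⟩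
    · rintro ⟨j, hj, rfl⟩
      by_cases hj2 : j < L.sum + 1
      · exact Or.inl ⟨j, hj2, rfl⟩
      · exact Or.inr ⟨_, ⟨j - x, by omega, rfl⟩, by rw [← add_nsmul]; congr 1; omega⟩

lemma scInt_replicate {b : G} [Finite G] (h : ℕ) (hf : scFree (Multiset.replicate h b)) :
    scInt b (Multiset.replicate h 1) := by
  induction h with
  | zero =>
    refine ⟨by simp, by simpa using addOrderOf_pos b, ?_⟩
    ext x; simp [mem_scSums, eq_comm]
  | succ h ih =>
    rw [Multiset.replicate_succ] at hf ⊢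
    apply (ih (hf.mono (Multiset.le_cons_self _ _))).cons le_rfl (by omega)
    simpa using hf

lemma scInt.stuck {b x : G} {L : Multiset ℕ} (h : scInt b L)
    (hf : scFree (x ::ₘ L.map (· • b))) (hx : ∀ j, j ≤ L.sum → x ≠ j • b) :
    (scSums (x ::ₘ L.map (· • b))).card = 2 * (L.sum + 1) := by
  obtain ⟨h1, h2, h3⟩ := h
  have hneg := hf.neg_notMem
  have hc : (scSums (L.map (· • b))).card = L.sum + 1 := by
    rw [h3, Finset.card_image_of_injOn, Finset.card_range]
    intro i hi j hj hij
    simp only [Finset.coe_range, Set.mem_Iio] at hi hj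
    exact nsmul_injOn_Iio_addOrderOf (by simp; omega) (by simp; omega) hij
  rw [scSums_cons_eq, Finset.card_union_of_disjoint,
    Finset.card_image_of_injective _ (add_left_injective x), hc]
  · ring
  · rw [Finset.disjoint_left]
    intro y hy hy2
    obtain ⟨z, hz, rfl⟩ := Finset.mem_image.1 hy2
    rw [h3, Finset.mem_image] at hy hz hneg
    obtain ⟨i, hi, rfl⟩ := hz
    obtain ⟨j, hj, hij⟩ := hy
    rw [Finset.mem_range] at hi hj
    by_cases hle : i ≤ j
    · apply hx (j - i) (by omega)
      have : j • b = i • b + (j - i) • b := by rw [← add_nsmul]; congr 1; omega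
      rw [this] at hij
      exact (add_left_cancel hij).symm
    · apply hneg
      refine ⟨i - j, by rw [Finset.mem_range]; omega, ?_⟩
      have : i • b = j • b + (i - j) • b := by rw [← add_nsmul]; congr 1; omega
      rw [this, add_assoc] at hij
      have h0 : (i - j) • b + x = 0 := by
        have : j • b + 0 = j • b + ((i - j) • b + x) := by rw [add_zero]; exact hij
        exact (add_left_cancel this).symm
      exact eq_neg_of_add_eq_zero_left h0

lemma scInt.card_le_sum {b : G} {L : Multiset ℕ} (h : scInt b L) : Multiset.card L ≤ L.sum := by
  have := Multiset.card_nsmul_le_sum (s := L) (a := 1) h.1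
  simpa using this

/-- Savchev and Chen structure theorem -/
theorem savchev_chen [Finite G] {S : Multiset G} (hS : scFree S)
    (hlen : Nat.card G < 2 * Multiset.card S) :
    ∃ b : G, ∃ L : Multiset ℕ, scInt b L ∧ L.map (· • b) = S := by
  have hsmall : (scSums S).card < 2 * Multiset.card S := by
    have := Fintype.ofFinite G
    rw [Nat.card_eq_fintype_card] at hlen
    exact (Finset.card_le_univ _).trans_lt hlen
  obtain ⟨z, hz⟩ : ∃ z, z ∈ S := Multiset.card_pos_iff_exists_mem.1 (by omega)
  have hz0 : z ≠ 0 := hS.ne_zero hz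
  have hzc : (scSums {z}).card = 2 := by
    have : scSums {z} = {0, z} := by
      rw [← Multiset.cons_zero, scSums_cons_eq]
      ext y
      have h1 : (0 = y + -z) ↔ y = z := by rw [eq_comm, add_neg_eq_zero]
      have h2 : (0 = y) ↔ y = 0 := eq_comm
      simp [mem_scSums, h1, h2]
    rw [this, Finset.card_pair hz0.symm]
  obtain ⟨b, S1, hb, -, hb1⟩ := sc_E _ rfl hS (Multiset.singleton_ne_zero z)
    (Multiset.singleton_le.2 hz) (by rw [hzc, Multiset.card_singleton]; omega)
  refine ⟨b, ?_⟩
  have key : ∀ m, ∀ L, scInt b L → L.map (· • b) ≤ S →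
      Multiset.count b (L.map (· • b)) = Multiset.count b S →
      Multiset.card S - Multiset.card L = m →
      ∃ L : Multiset ℕ, scInt b L ∧ L.map (· • b) = S := by
    intro m
    induction m with
    | zero =>
      intro L hL hle _ hm
      exact ⟨L, hL, Multiset.eq_of_le_of_card_le hle (by rw [Multiset.card_map]; omega)⟩
    | succ m ih =>
      intro L hL hle hcnt hm
      have hadd := tsub_add_cancel_of_le hle
      obtain ⟨x, hx⟩ : ∃ x, x ∈ S - L.map (· • b) := Multiset.card_pos_iff_exists_mem.1 (by
        rw [Multiset.card_sub hle, Multiset.card_map]; omega)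
      have hle2 : x ::ₘ L.map (· • b) ≤ S := by
        rw [← hadd, ← Multiset.singleton_add]
        exact add_le_add_left (Multiset.singleton_le.2 hx) _
      have hf := hS.mono hle2
      have hx0 : x ≠ 0 := hf.ne_zero (Multiset.mem_cons_self _ _)
      by_cases hst : ∃ j, j ≤ L.sum + 1 ∧ x = j • b
      · obtain ⟨j, hj, rfl⟩ := hst
        have hj1 : 1 ≤ j := by
          rcases Nat.eq_zero_or_pos j with rfl | h
          · simp at hx0
          · exact h
        refine ih (j ::ₘ L) (hL.cons hj1 hj hf) (by rwa [Multiset.map_cons]) ?_ (by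
          rw [Multiset.card_cons]; omega)
        apply le_antisymm (Multiset.count_le_of_le _ (by rwa [Multiset.map_cons]))
        rw [← hcnt, Multiset.map_cons]
        exact Multiset.count_le_of_le _ (Multiset.le_cons_self _ _)
      · push Not at hst
        exfalso
        have hc := hL.stuck hf (fun j hj => hst j (by omega))
        have hls := hL.card_le_sum
        obtain ⟨c, S2, hc2, hle3, hc1⟩ := sc_E _ rfl hS Multiset.cons_ne_zero hle2 (by
          rw [hc, Multiset.card_cons, Multiset.card_map]; omega)
        have hbc : b = c := sc_U hS hb hc2 hb1 hc1
        subst hbc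
        have h5 := Multiset.count_le_of_le b ((Multiset.le_cons_self _ _).trans hle3)
        rw [hcnt, hc2, Multiset.count_cons_self] at h5
        omega
  have hrep : Multiset.replicate (Multiset.count b S) b ≤ S := Multiset.le_count_iff_replicate_le.1 le_rfl
  refine key _ (Multiset.replicate (Multiset.count b S) 1) (scInt_replicate _ (hS.mono hrep)) ?_ ?_ rfl
  · simpa using hrep
  · simp
end SC

noncomputable def ctsG (n k : ℕ) [NeZero n] (a : ZMod n) : Finset (ZMod n) := by
  classical
  exact (Finset.univ.filter (fun g : ZMod n => IsUnit g ∧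
      ∃ x ∈ Finset.Ioc 0 (k + 1), (x : ZMod n) * g = a))

lemma mem_ctsG {n k : ℕ} [NeZero n] {a g : ZMod n} : g ∈ ctsG n k a ↔ IsUnit g ∧
    ∃ x ∈ Finset.Ioc 0 (k + 1), (x : ZMod n) * g = a := by
  classical
  simp [ctsG]

lemma gen_count (n k : ℕ) [NeZero n] (a : ZMod n) :
    (ctsG n k a).card ≤ k + 1 := by
  classical
  set e := Nat.gcd a.val n with he
  have hn : 0 < n := Nat.pos_of_ne_zero (NeZero.ne n)
  have hsub : (ctsG n k a) ⊆
      ((Finset.Ioc 0 (k+1)).filter (fun x => e ∣ x)).biUnion (fun x =>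
        Finset.univ.filter (fun g : ZMod n => Nat.gcd x n = e ∧ (x : ZMod n) * g = a)) := by
    intro g hg
    rw [mem_ctsG] at hg
    obtain ⟨hu, x, hx, hxa⟩ := hg
    have hgcd : Nat.gcd x n = e := by
      have hcop : Nat.Coprime g.val n := (ZMod.isUnit_iff_coprime g.val n).1 (by simpa using hu)
      have hmod : a.val ≡ x * g.val [MOD n] := by
        rw [← ZMod.natCast_eq_natCast_iff]
        push_cast
        simp [hxa]
      rw [he, hmod.gcd_eq, Nat.Coprime.gcd_mul_right_cancel _ hcop]
    simp only [Finset.mem_biUnion, Finset.mem_filter, Finset.mem_univ, true_and]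
    exact ⟨x, ⟨hx, hgcd ▸ Nat.gcd_dvd_left x n⟩, hgcd, hxa⟩
  have hfib : ∀ x ∈ (Finset.Ioc 0 (k+1)).filter (fun x => e ∣ x),
      (Finset.univ.filter (fun g : ZMod n => Nat.gcd x n = e ∧ (x : ZMod n) * g = a)).card ≤ e := by
    intro x _
    rcases Finset.eq_empty_or_nonempty
      (Finset.univ.filter (fun g : ZMod n => Nat.gcd x n = e ∧ (x : ZMod n) * g = a)) with h | h
    · rw [h]; simp
    · obtain ⟨g0, hg0⟩ := h
      simp only [Finset.mem_filter, Finset.mem_univ, true_and] at hg0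
      have he0 : 0 < e := Nat.gcd_pos_of_pos_right _ hn
      refine le_trans ?_ (IsAddCyclic.card_nsmul_eq_zero_le (α := ZMod n) he0)
      apply Finset.card_le_card_of_injOn (fun g => g - g0)
      · intro g hg
        simp only [Finset.coe_filter, Finset.mem_univ, true_and, Set.mem_ofPred_eq] at hg ⊢
        have hz : (x : ZMod n) * (g - g0) = 0 := by rw [mul_sub, hg.2, hg0.2, sub_self]
        have hbez := Nat.gcd_eq_gcd_ab x n
        rw [hg0.1] at hbez
        have : ((e : ℤ) : ZMod n) = x * (Nat.gcdA x n : ZMod n) := by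
          rw [hbez]; push_cast; simp
        rw [nsmul_eq_mul]
        have h2 : (e : ZMod n) = x * (Nat.gcdA x n : ZMod n) := by exact_mod_cast this
        rw [h2, mul_right_comm, hz, zero_mul]
      · intro g _ g' _ h
        exact sub_left_injective h
  calc _ ≤ _ := Finset.card_le_card hsub
    _ ≤ _ := Finset.card_biUnion_le_card_mul _ _ e hfib
    _ = (k+1) / e * e := by rw [Nat.Ioc_filter_dvd_card_eq_div]
    _ ≤ k + 1 := Nat.div_mul_le_self _ _

noncomputable def ctsPF (k d i : ℕ) : Finset (Multiset ℕ) := by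
  classical
  exact (Finset.range (i+1)).biUnion fun j => (Finset.range (k - i + 1 + 1)).biUnion fun s =>
    ((Finset.univ : Finset (Nat.Partition s)).filter
      (fun l => l.parts.toFinset.card = d - 1 - j)).image (fun l => l.parts)

lemma ctsPF_card (k d i : ℕ) :
    (ctsPF k d i).card ≤ ∑ j ∈ Finset.range (i + 1), X (k - i + 1) (d - 1 - j) := by
  classical
  unfold ctsPF X
  refine Finset.card_biUnion_le.trans (Finset.sum_le_sum fun j _ => ?_)
  refine Finset.card_biUnion_le.trans (Finset.sum_le_sum fun s _ => ?_)
  refine Finset.card_image_le.trans ?_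
  rw [numPartsDistinct, Nat.card_eq_fintype_card, Fintype.card_subtype]

lemma mem_ctsPF {k d i : ℕ} {μ : Multiset ℕ} (h0 : ∀ x ∈ μ, 0 < x) (hs : μ.sum ≤ k - i + 1)
    (h1 : μ.toFinset.card ≤ d - 1) (h2 : d - 1 ≤ μ.toFinset.card + i) : μ ∈ ctsPF k d i := by
  classical
  unfold ctsPF
  simp only [Finset.mem_biUnion, Finset.mem_range, Finset.mem_image, Finset.mem_filter,
    Finset.mem_univ, true_and]
  exact ⟨d - 1 - μ.toFinset.card, by omega, μ.sum, by omega,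
    ⟨μ, fun {x} hx => h0 x hx, rfl⟩, by show μ.toFinset.card = _; omega, rfl⟩

noncomputable def ctsB {n : ℕ} (A : Finset (ZMod n)) (g : ZMod n) : Finset ℕ :=
  (A.erase g).image (fun a => (a * g⁻¹).val - 1)

noncomputable def ctsDec {n : ℕ} (A : Finset (ZMod n)) (l : ℕ) (p : ZMod n × Multiset ℕ) :
    Multiset (ZMod n) :=
  (((p.2 + (ctsB A p.1).val).map (· + 1)) +
    Multiset.replicate (l - Multiset.card (p.2 + (ctsB A p.1).val)) 1).map (· • p.1)

lemma list_decomp (L : Multiset ℕ) (h : ∀ x ∈ L, 1 ≤ x) :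
    ((L.filter (fun x => 1 < x)).map (· - 1)).sum + Multiset.card L = L.sum ∧
    ((L.filter (fun x => 1 < x)).map (· - 1)).map (· + 1) +
      Multiset.replicate (Multiset.card L - Multiset.card ((L.filter (fun x => 1 < x)).map (· - 1))) 1 = L := by
  induction L using Multiset.induction with
  | empty => simp
  | cons a L ih =>
    obtain ⟨h1, h2⟩ := ih (fun x hx => h x (Multiset.mem_cons_of_mem hx))
    have ha := h a (Multiset.mem_cons_self _ _)
    have hle : Multiset.card (L.filter (fun x => 1 < x)) ≤ Multiset.card L :=
      Multiset.card_le_card (Multiset.filter_le _ _)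
    by_cases ha1 : 1 < a
    · have hfil : (a ::ₘ L).filter (fun x => 1 < x) = a ::ₘ L.filter (fun x => 1 < x) :=
        Multiset.filter_cons_of_pos _ ha1
      rw [hfil]
      simp only [Multiset.map_cons, Multiset.sum_cons, Multiset.card_cons, Multiset.cons_add]
      refine ⟨by omega, ?_⟩
      rw [Nat.sub_add_cancel ha]
      congr 1
      rw [Nat.add_sub_add_right]
      exact h2
    · have hfil : (a ::ₘ L).filter (fun x => 1 < x) = L.filter (fun x => 1 < x) :=
        Multiset.filter_cons_of_neg _ ha1
      rw [hfil]
      obtain rfl : a = 1 := by omega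
      simp only [Multiset.sum_cons, Multiset.card_cons]
      refine ⟨by omega, ?_⟩
      rw [Nat.sub_add_comm (by simpa using hle), Multiset.replicate_succ, Multiset.add_cons, h2]

lemma cts_main (n k d i : ℕ) [NeZero n] (hk : 2 * k + 2 < n)
    (hi : 1 ≤ i) (A : Finset (ZMod n)) (hA : A.card = i)
    (a : ZMod n) (ha : a ∈ A) (S : Multiset (ZMod n)) (hc : Multiset.card S = n - 1 - k)
    (hS : ZeroSumFree S) (hd : S.toFinset.card = d) (hAS : A ⊆ S.toFinset) :
    ∃ p ∈ (ctsG n k a) ×ˢ ctsPF k d i,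
      ctsDec A (n - 1 - k) p = S := by
  classical
  obtain ⟨g, L, ⟨hL1, hL2, -⟩, hLS⟩ := savchev_chen (S := S) hS (by rw [Nat.card_zmod]; omega)
  have hcL : Multiset.card L = n - 1 - k := by rw [← hc, ← hLS, Multiset.card_map]
  obtain ⟨hsum, hdec⟩ := list_decomp L hL1
  set lam := (L.filter (fun x => 1 < x)).map (· - 1) with hlam
  have hcs : Multiset.card L ≤ L.sum := by omega
  have hord : addOrderOf g = n := by
    have h1 : addOrderOf g ∣ n := by
      have := addOrderOf_dvd_natCard g
      rwa [Nat.card_zmod] at this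
    obtain ⟨c, hc⟩ := h1
    have : c < 2 := by
      by_contra h
      have : addOrderOf g * 2 ≤ addOrderOf g * c := Nat.mul_le_mul_left _ (by omega)
      omega
    interval_cases c <;> omega
  rw [hord] at hL2
  have hu : IsUnit g := by
    have h1 := ZMod.addOrderOf_coe g.val (NeZero.ne n)
    rw [ZMod.natCast_zmod_val, hord] at h1
    have h2 : Nat.Coprime g.val n := by
      rw [Nat.coprime_comm, Nat.coprime_iff_gcd_eq_one]
      have h3 := Nat.div_mul_cancel (Nat.gcd_dvd_left n g.val)
      rw [← h1] at h3
      exact Nat.eq_of_mul_eq_mul_left (by omega) (h3.trans (mul_one n).symm)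
    simpa using (ZMod.isUnit_iff_coprime g.val n).2 h2
  have hginv : g * g⁻¹ = 1 := ZMod.mul_inv_of_unit g hu
  have hval : ∀ x, x < n → ((x • g) * g⁻¹).val = x := by
    intro x hx
    rw [nsmul_eq_mul, mul_assoc, hginv, mul_one, ZMod.val_natCast, Nat.mod_eq_of_lt hx]
  have hxn : ∀ x ∈ L, x ≤ L.sum := fun x hx => Multiset.le_sum_of_mem hx
  have hlampos : ∀ y ∈ lam, 0 < y := by
    intro y hy
    simp only [hlam, Multiset.mem_map, Multiset.mem_filter] at hy
    obtain ⟨x, ⟨_, hx⟩, rfl⟩ := hy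
    omega
  have hlamsum : lam.sum ≤ k := by omega
  have hlamcard : Multiset.card lam ≤ lam.sum := by
    have := Multiset.card_nsmul_le_sum (s := lam) (a := 1) hlampos
    simpa using this
  have hmemA : ∀ c ∈ A, ∃ x ∈ L, x • g = c := by
    intro c hc
    have := hAS hc
    rw [Multiset.mem_toFinset, ← hLS, Multiset.mem_map] at this
    exact this
  have hxk : ∀ x ∈ L, x ≤ k + 1 := by
    intro x hx
    by_cases h1 : 1 < x
    · have : x - 1 ∈ lam := by
        rw [hlam]; exact Multiset.mem_map_of_mem _ (Multiset.mem_filter.2 ⟨hx, h1⟩)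
      have := Multiset.le_sum_of_mem this
      omega
    · omega
  have h1L : 1 ∈ L := by
    rw [← hdec, Multiset.mem_add]
    right
    rw [Multiset.mem_replicate]
    exact ⟨by omega, rfl⟩
  have hLd : L.toFinset.card = d := by
    rw [← hd, ← hLS, Multiset.toFinset_map, Finset.card_image_of_injOn]
    intro x hx y hy hxy
    simp only [Finset.mem_coe, Multiset.mem_toFinset] at hx hy
    have hx := hxn x hx
    have hy := hxn y hy
    rw [← hval x (by omega), ← hval y (by omega)]
    simp only at hxy
    rw [hxy]
  have hlamd : lam.toFinset.card = d - 1 := by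
    have : lam.toFinset = (L.toFinset.erase 1).image (· - 1) := by
      ext y
      simp only [hlam, Multiset.mem_toFinset, Multiset.mem_map, Multiset.mem_filter,
        Finset.mem_image, Finset.mem_erase]
      constructor
      · rintro ⟨x, ⟨hx, h1⟩, rfl⟩
        exact ⟨x, ⟨by omega, hx⟩, rfl⟩
      · rintro ⟨x, ⟨h1, hx⟩, rfl⟩
        have := hL1 x hx
        exact ⟨x, ⟨hx, by omega⟩, rfl⟩
    rw [this, Finset.card_image_of_injOn, Finset.card_erase_of_mem (by simpa using h1L), hLd]
    intro x hx y hy hxy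
    simp only [Finset.coe_erase, Set.mem_sdiff, Finset.mem_coe, Multiset.mem_toFinset] at hx hy
    have := hL1 x hx.1
    have := hL1 y hy.1
    simp only at hxy
    omega
  -- properties of B
  have hBmem : ∀ c ∈ A.erase g, ∃ x ∈ L, 1 < x ∧ x • g = c ∧ (c * g⁻¹).val = x := by
    intro c hc
    obtain ⟨hcg, hcA⟩ := Finset.mem_erase.1 hc
    obtain ⟨x, hx, rfl⟩ := hmemA c hcA
    have h1 := hL1 x hx
    have : x ≠ 1 := by rintro rfl; simp at hcg
    exact ⟨x, hx, by omega, rfl, hval x (by have := hxn x hx; omega)⟩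
  have hBle : (ctsB A g).val ≤ lam := by
    rw [Multiset.le_iff_subset (ctsB A g).nodup]
    intro y hy
    have hy : y ∈ ctsB A g := hy
    obtain ⟨c, hc, rfl⟩ := Finset.mem_image.1 hy
    obtain ⟨x, hx, h1, _, h2⟩ := hBmem c hc
    simp only [h2]
    rw [hlam]; exact Multiset.mem_map_of_mem _ (Multiset.mem_filter.2 ⟨hx, h1⟩)
  have hBcard : (ctsB A g).card = (A.erase g).card := by
    apply Finset.card_image_of_injOn
    intro c hc c' hc' h
    obtain ⟨x, hx, h1, h3, h2⟩ := hBmem c hc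
    obtain ⟨x', hx', h1', h3', h2'⟩ := hBmem c' hc'
    simp only [h2, h2'] at h
    rw [← h3, ← h3']
    congr 1; omega
  have hAe1 : i - 1 ≤ (A.erase g).card := by rw [← hA]; exact Finset.pred_card_le_card_erase
  have hAe2 : (A.erase g).card ≤ i := by rw [← hA]; exact Finset.card_erase_le
  have hadd : lam - (ctsB A g).val + (ctsB A g).val = lam := tsub_add_cancel_of_le hBle
  have hBsum : (ctsB A g).card ≤ (ctsB A g).val.sum := by
    have := Multiset.card_nsmul_le_sum (s := (ctsB A g).val) (a := 1)
      (fun x hx => hlampos x (Multiset.mem_of_le hBle hx))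
    simpa using this
  refine ⟨(g, lam - (ctsB A g).val), ?_, ?_⟩
  · rw [Finset.mem_product]
    constructor
    · rw [mem_ctsG]
      obtain ⟨x, hx, hxa⟩ := hmemA a ha
      exact ⟨hu, x, Finset.mem_Ioc.2 ⟨hL1 x hx, hxk x hx⟩, by rw [← hxa, nsmul_eq_mul]⟩
    · have e1 := congrArg Multiset.sum hadd
      rw [Multiset.sum_add] at e1
      apply mem_ctsPF
      · exact fun x hx => hlampos x (Multiset.mem_of_le tsub_le_self hx)
      · simp only; omega
      · rw [← hlamd]
        exact Finset.card_le_card (Multiset.toFinset_subset.2 (Multiset.subset_of_le tsub_le_self))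
      · have e2 := congrArg Multiset.toFinset hadd
        rw [Multiset.toFinset_add] at e2
        rw [← hlamd, ← e2]
        refine (Finset.card_union_le _ _).trans ?_
        have : (ctsB A g).val.toFinset = ctsB A g := Finset.val_toFinset _
        simp only
        rw [this]
        omega
  · unfold ctsDec
    simp only
    rw [hadd, ← hcL, hdec, hLS]

lemma npd_eq (j d : ℕ) : numPartsDistinct j d =
    ((Finset.univ : Finset (Nat.Partition j)).filter (fun l => l.parts.toFinset.card = d)).card := by
  rw [numPartsDistinct, Nat.card_eq_fintype_card, Fintype.card_subtype]

lemma X_one : 2 ≤ X 1 1 + X 1 0 := by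
  simp only [X, npd_eq, Finset.sum_range_succ, Finset.sum_range_zero]
  decide

lemma X_two : 4 ≤ X 2 1 + X 2 0 := by
  have h1 := X_one
  have h2 : 1 < numPartsDistinct 2 1 := by
    rw [npd_eq, Finset.one_lt_card]
    refine ⟨⟨{2}, by simp, by simp⟩, by simp, ⟨{1, 1}, by simp, by simp⟩, by simp, ?_⟩
    intro h
    have := congrArg (fun p : Nat.Partition 2 => Multiset.card p.parts) h
    simp at this
  simp only [X, Finset.sum_range_succ, Finset.sum_range_zero] at h1 ⊢
  omega

lemma Dk_bound {k d : ℕ} (h : d ≤ Dk k) (hd : 1 ≤ d) : d * (d - 1) ≤ 2 * k := by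
  unfold Dk at h
  rw [Nat.le_floor_iff (by positivity)] at h
  have h1 : (2 * (d : ℝ) - 1) ≤ Real.sqrt (1 + 8 * (k : ℝ)) := by linarith
  have hd' : (1 : ℝ) ≤ d := by exact_mod_cast hd
  have h2 : (2 * (d : ℝ) - 1) ^ 2 ≤ 1 + 8 * (k : ℝ) := by
    have := Real.sq_sqrt (show (0:ℝ) ≤ 1 + 8 * (k : ℝ) by positivity)
    rw [← this]
    exact pow_le_pow_left₀ (by linarith) h1 2
  have h3 : (d : ℝ) * (d - 1) ≤ 2 * k := by nlinarith
  have h4 : ((d * (d - 1) : ℕ) : ℝ) ≤ ((2 * k : ℕ) : ℝ) := by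
    push_cast [Nat.cast_sub hd]
    exact h3
  exact_mod_cast h4

lemma card_le_of_dec {α β : Type*} [DecidableEq α] (P : α → Prop) (s : Finset β) (f : β → α)
    (h : ∀ a, P a → ∃ p ∈ s, f p = a) : Nat.card {a // P a} ≤ s.card := by
  have h1 : {a | P a} ⊆ (s.image f : Finset α) := by
    intro a ha
    obtain ⟨p, hp, rfl⟩ := h a ha
    simp only [Finset.coe_image]
    exact ⟨p, hp, rfl⟩
  have h2 := Set.ncard_le_ncard h1 (Finset.finite_toSet _)
  rw [Set.ncard_coe_finset] at h2
  exact h2.trans Finset.card_image_le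

lemma le_choose_mid (k : ℕ) : ∀ j, 1 ≤ j → j + 1 ≤ k → k ≤ Nat.choose k j := by
  induction k with
  | zero => intro j _ h; omega
  | succ k ih =>
    intro j hj hjk
    obtain ⟨j, rfl⟩ : ∃ t, j = t + 1 := ⟨j - 1, by omega⟩
    rcases Nat.eq_zero_or_pos j with rfl | hj0
    · simp
    · rw [Nat.choose_succ_succ]
      have h1 := ih j hj0 (by omega)
      have h2 : 0 < Nat.choose k (j + 1) := Nat.choose_pos (by omega)
      simp only [Nat.succ_eq_add_one]
      omega

lemma bracket {k i : ℕ} (hi : 1 ≤ i) (hik : i ≤ k) :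
    k + 1 ≤ i * Nat.choose k (i - 1) + Nat.choose k i := by
  obtain ⟨j, rfl⟩ : ∃ j, i = j + 1 := ⟨i - 1, by omega⟩
  rcases Nat.eq_zero_or_pos j with rfl | hj
  · simp
  · have h1 : k ≤ Nat.choose k j := le_choose_mid k j hj hik
    rw [Nat.add_sub_cancel]
    nlinarith

theorem count_through_set (n k d i : ℕ) (hn : 2 ≤ n) (hk : k ≤ n / 3)
    (hi : 1 ≤ i) (hid : i < d) (hdD : d ≤ Dk k)
    (A : Finset (ZMod n)) (hA : A.card = i) :
    Nat.card {S : Multiset (ZMod n) //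
        Multiset.card S = n - 1 - k ∧ ZeroSumFree S ∧ S.toFinset.card = d ∧
          A ⊆ S.toFinset}
      ≤ (i * Nat.choose k (i - 1) + Nat.choose k i) *
          ∑ j ∈ Finset.range (i + 1), X (k - i + 1) (d - 1 - j) := by
  classical
  have hdd := Dk_bound hdD (by omega)
  have hd1 : d - 1 ≤ k := by
    have : 2 * (d - 1) ≤ d * (d - 1) := Nat.mul_le_mul_right _ (by omega)
    omega
  have hik : i ≤ k := by omega
  have : NeZero n := ⟨by omega⟩
  obtain ⟨a, ha⟩ : A.Nonempty := Finset.card_pos.1 (by omega)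
  by_cases hbig : 2 * k + 2 < n
  · refine (card_le_of_dec _ (ctsG n k a ×ˢ ctsPF k d i) (ctsDec A (n - 1 - k)) ?_).trans ?_
    · rintro S ⟨h1, h2, h3, h4⟩
      exact cts_main n k d i hbig hi A hA a ha S h1 h2 h3 h4
    · rw [Finset.card_product]
      exact Nat.mul_le_mul ((gen_count n k a).trans (bracket hi hik)) (ctsPF_card k d i)
  · have hk2 : k = 1 ∨ k = 2 := by omega
    have hd2 : d = 2 := by
      by_contra hne
      have h3 : 3 ≤ d := by omega
      have : 3 * 2 ≤ d * (d - 1) := Nat.mul_le_mul h3 (by omega)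
      omega
    subst hd2
    obtain rfl : i = 1 := by omega
    rcases hk2 with rfl | rfl
    · have hn4 : n ≤ 4 := by omega
      refine (card_le_of_dec _ (Finset.univ : Finset (ZMod n)) (fun y => {a, y}) ?_).trans ?_
      · rintro S ⟨h1, h2, h3, h4⟩
        have haS := Multiset.mem_toFinset.1 (h4 ha)
        obtain ⟨S', rfl⟩ := Multiset.exists_cons_of_mem haS
        have h5 := Multiset.toFinset_card_le (a ::ₘ S')
        rw [Multiset.card_cons] at h1 h5
        obtain ⟨y, rfl⟩ := Multiset.card_eq_one.1 (show Multiset.card S' = 1 by omega)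
        exact ⟨y, Finset.mem_univ _, rfl⟩
      · rw [Finset.card_univ, ZMod.card]
        have := X_one
        simp [Finset.sum_range_succ]
        omega
    · have hn6 : n = 6 := by omega
      refine (card_le_of_dec _ (Finset.univ : Finset (ZMod n × Bool))
        (fun y => if y.2 then {a, a, y.1} else {a, y.1, y.1}) ?_).trans ?_
      · rintro S ⟨h1, h2, h3, h4⟩
        have haS := Multiset.mem_toFinset.1 (h4 ha)
        obtain ⟨S', rfl⟩ := Multiset.exists_cons_of_mem haS
        rw [Multiset.card_cons] at h1
        obtain ⟨p, q, rfl⟩ := Multiset.card_eq_two.1 (show Multiset.card S' = 2 by omega)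
        by_cases hp : p = a
        · subst hp
          exact ⟨(q, true), Finset.mem_univ _, rfl⟩
        by_cases hq : q = a
        · subst hq
          refine ⟨(p, true), Finset.mem_univ _, ?_⟩
          exact congrArg (q ::ₘ ·) (Multiset.pair_comm q p)
        by_cases hpq : p = q
        · subst hpq
          exact ⟨(p, false), Finset.mem_univ _, rfl⟩
        exfalso
        have : (a ::ₘ {p, q} : Multiset (ZMod n)).toFinset = {a, p, q} := by ext; simp
        rw [this, Finset.card_eq_three.2 ⟨a, p, q, Ne.symm hp, Ne.symm hq, hpq, rfl⟩] at h3
        omega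
      · rw [Finset.card_univ, Fintype.card_prod, ZMod.card, Fintype.card_bool]
        have := X_two
        simp [Finset.sum_range_succ]
        omega
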